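/- Let K be a field, V a K-vector space of finite dimension r + 1 with r ≥ 1, and S ⊆ ℙ(V) a finite set of cardinality t ≥ r in general linear position. Let B ⊆ S with |B| = r − 1. Then the number of subsets A ⊆ S with |A| = r and span(B) ≤ span(A) is exactly t − r + 1. -/

import Mathlib

/-- The submodule of `V` spanned by the lines corresponding to a finite set of
points of the projectivization `ℙ K V`. -/
def pspan (K : Type*) {V : Type*} [Field K] [AddCommGroup V] [Module K V]
    (A : Finset (Projectivization K V)) : Submodule K V :=
  ⨆ P ∈ A, P.submodule

/-- A finite set `S ⊆ ℙ K V` is in general linear position (with respect to `r`,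
where `finrank K V = r + 1`) if every subset `T ⊆ S` with `|T| ≤ r + 1` spans a
submodule of dimension `|T|`. -/
def InGenLinPos (K : Type*) {V : Type*} [Field K] [AddCommGroup V] [Module K V]
    (r : ℕ) (S : Finset (Projectivization K V)) : Prop :=
  ∀ T ⊆ S, T.card ≤ r + 1 → Module.finrank K (pspan K T) = T.card

theorem pspan_mono {K V : Type*} [Field K] [AddCommGroup V] [Module K V]
    {A B : Finset (Projectivization K V)} (h : B ⊆ A) : pspan K B ≤ pspan K A :=
  biSup_mono fun _ hP => h hP

theorem submodule_le_pspan {K V : Type*} [Field K] [AddCommGroup V] [Module K V]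
    {A : Finset (Projectivization K V)} {P : Projectivization K V} (h : P ∈ A) :
    P.submodule ≤ pspan K A :=
  le_biSup Projectivization.submodule h

/-- The span of at most `r` points of a set in general linear position contains no further
point of the set. -/
theorem InGenLinPos.mem_of_submodule_le_pspan {K V : Type*} [Field K] [AddCommGroup V]
    [Module K V] {r : ℕ} {S A : Finset (Projectivization K V)} {P : Projectivization K V}
    (hS : InGenLinPos K r S) (hA : A ⊆ S) (hAr : A.card ≤ r) (hP : P ∈ S)
    (h : P.submodule ≤ pspan K A) : P ∈ A := by
  classical
  by_contra hPA
  have hspan : pspan K (insert P A) = pspan K A := by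
    unfold pspan at h ⊢
    rw [Finset.iSup_insert, sup_eq_right.2 h]
  have hcard : (insert P A).card = A.card + 1 := Finset.card_insert_of_notMem hPA
  have h₁ := hS (insert P A) (Finset.insert_subset hP hA) (by omega)
  have h₂ := hS A hA (by omega)
  rw [hspan, h₂] at h₁
  omega

theorem InGenLinPos.pspan_le_pspan_iff {K V : Type*} [Field K] [AddCommGroup V]
    [Module K V] {r : ℕ} {S A B : Finset (Projectivization K V)}
    (hS : InGenLinPos K r S) (hA : A ⊆ S) (hAr : A.card ≤ r) (hB : B ⊆ S) :
    pspan K B ≤ pspan K A ↔ B ⊆ A :=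
  ⟨fun h _ hP => hS.mem_of_submodule_le_pspan hA hAr (hB hP) ((submodule_le_pspan hP).trans h),
    pspan_mono⟩

/-- The supersets of `B` inside `S` with one more element correspond to the elements of
`S \ B`. -/
theorem card_filter_superset_powersetCard_succ {α : Type*} [DecidableEq α] {S B : Finset α}
    (hB : B ⊆ S) :
    ((S.powersetCard (B.card + 1)).filter (fun A => B ⊆ A)).card = S.card - B.card := by
  rw [← Finset.card_sdiff_of_subset hB]
  symm
  refine Finset.card_bij (fun a _ => insert a B) ?_ ?_ ?_
  · intro a ha
    rw [Finset.mem_sdiff] at ha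
    simp only [Finset.mem_filter, Finset.mem_powersetCard]
    exact ⟨⟨Finset.insert_subset ha.1 hB, Finset.card_insert_of_notMem ha.2⟩,
      Finset.subset_insert a B⟩
  · intro a ha b _ hab
    exact (Finset.insert_inj (Finset.mem_sdiff.1 ha).2).1 hab
  · intro A hA
    simp only [Finset.mem_filter, Finset.mem_powersetCard] at hA
    obtain ⟨⟨hAS, hcard⟩, hBA⟩ := hA
    obtain ⟨a, haB, rfl⟩ := Finset.exists_eq_insert_iff.2 ⟨hBA, hcard.symm⟩
    exact ⟨a, Finset.mem_sdiff.2 ⟨hAS (Finset.mem_insert_self a B), haB⟩, rfl⟩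

open scoped Classical in
theorem card_hyperplanes_through_codim_two
    {K V : Type*} [Field K] [AddCommGroup V] [Module K V]
    (r t : ℕ) (hr : 1 ≤ r) (hrt : r ≤ t)
    (hdim : Module.finrank K V = r + 1)
    (S : Finset (Projectivization K V)) (hScard : S.card = t)
    (hS : InGenLinPos K r S)
    (B : Finset (Projectivization K V)) (hBS : B ⊆ S) (hB : B.card = r - 1) :
    ((S.powersetCard r).filter (fun A => pspan K B ≤ pspan K A)).card = t - r + 1 := by
  have hBr : B.card + 1 = r := by omega
  have hfilter : (S.powersetCard r).filter (fun A => pspan K B ≤ pspan K A) =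
      (S.powersetCard (B.card + 1)).filter (fun A => B ⊆ A) := by
    rw [hBr]
    refine Finset.filter_congr fun A hA => ?_
    rw [Finset.mem_powersetCard] at hA
    exact hS.pspan_le_pspan_iff hA.1 hA.2.le hBS
  rw [hfilter, card_filter_superset_powersetCard_succ hBS]
  omega
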